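/- Let T_1, T_2 ∈ F[x_1,…,x_n] be products of linear forms, homogeneous of equal degree m ≥ 1, with no common linear factor (gcd(T_1,T_2) = 1). Suppose T_1 + T_2 has no linear factors, and that for each i ∈ {1,2} the linear factors of T_i span an F-subspace of dimension at least 3. Then every linear form dividing T_1·T_2 is a candidate linear form for T_1 + T_2, i.e. every linear factor of T_1·T_2 belongs (up to scalar multiples) to L(T_1 + T_2). -/

import Mathlib

open MvPolynomial

/-- A linear form: a nonzero homogeneous degree-1 polynomial. -/
def IsLinearForm {F : Type*} [Field F] {n : ℕ} (ℓ : MvPolynomial (Fin n) F) : Prop :=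
  ℓ ≠ 0 ∧ ℓ.IsHomogeneous 1

/-- A product of linear forms (a nonzero scalar multiple of a product of linear forms). -/
def IsProdLinearForms {F : Type*} [Field F] {n : ℕ} (g : MvPolynomial (Fin n) F) : Prop :=
  ∃ (c : F) (L : Multiset (MvPolynomial (Fin n) F)),
    c ≠ 0 ∧ (∀ p ∈ L, IsLinearForm p) ∧ g = c • L.prod

/-- `g` has no linear factors. -/
def NoLinearFactor {F : Type*} [Field F] {n : ℕ} (g : MvPolynomial (Fin n) F) : Prop :=
  ∀ ℓ : MvPolynomial (Fin n) F, IsLinearForm ℓ → ¬ ℓ ∣ g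

/-- `h` is the non-linear part `NonLin(f)` of `f` (up to scalars): `h` has no linear
factors and `f` is a product of linear forms times `h`. -/
def IsNonLinPart {F : Type*} [Field F] {n : ℕ} (f h : MvPolynomial (Fin n) F) : Prop :=
  NoLinearFactor h ∧ ∃ L : MvPolynomial (Fin n) F, IsProdLinearForms L ∧ f = L * h

/-- `S(g)`: the set of codimension-2 subspaces `V(ℓ₁,ℓ₂)` of `F^n` on which `g`
vanishes, i.e. `g` belongs to the ideal generated by `ℓ₁, ℓ₂`. -/
def vanishCodim2 {F : Type*} [Field F] {n : ℕ} (g : MvPolynomial (Fin n) F) :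
    Set (Set (Fin n → F)) :=
  {W | ∃ ℓ₁ ℓ₂ : MvPolynomial (Fin n) F, IsLinearForm ℓ₁ ∧ IsLinearForm ℓ₂ ∧
    LinearIndependent F ![ℓ₁, ℓ₂] ∧
    W = {a : Fin n → F | eval a ℓ₁ = 0 ∧ eval a ℓ₂ = 0} ∧
    g ∈ Ideal.span {ℓ₁, ℓ₂}}

/-- `g` factorizes into non-zero linear forms on the hyperplane `V(ℓ)`: modulo `ℓ`, `g`
is a nonzero scalar times a product of linear forms none of which is a multiple of `ℓ`
(so each restricts to a nonzero linear form on `V(ℓ)`). -/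
def FactorsIntoLinearOn {F : Type*} [Field F] {n : ℕ} (g ℓ : MvPolynomial (Fin n) F) : Prop :=
  ∃ (c : F) (L : Multiset (MvPolynomial (Fin n) F)), c ≠ 0 ∧
    (∀ p ∈ L, IsLinearForm p ∧ p ∉ Submodule.span F ({ℓ} : Set (MvPolynomial (Fin n) F))) ∧
    g - c • L.prod ∈ Ideal.span {ℓ}

/-- `ℓ` is a candidate linear form for `g`: (i) `g` factorizes into nonzero linear forms
on `V(ℓ)`, and (ii) there are linear forms `ℓ₁, ℓ₂` with `ℓ, ℓ₁, ℓ₂` linearly independent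
such that `g` vanishes on both `V(ℓ,ℓ₁)` and `V(ℓ,ℓ₂)`. -/
def IsCandidateLinearForm {F : Type*} [Field F] {n : ℕ} (g ℓ : MvPolynomial (Fin n) F) : Prop :=
  IsLinearForm ℓ ∧ FactorsIntoLinearOn g ℓ ∧
  ∃ ℓ₁ ℓ₂ : MvPolynomial (Fin n) F, IsLinearForm ℓ₁ ∧ IsLinearForm ℓ₂ ∧
    LinearIndependent F ![ℓ, ℓ₁, ℓ₂] ∧
    g ∈ Ideal.span {ℓ, ℓ₁} ∧ g ∈ Ideal.span {ℓ, ℓ₂}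

/-- A set spanning a space of dimension more than `k` is not contained in the span of `k`
vectors. -/
theorem exists_mem_notMem_span_range {K V : Type*} [DivisionRing K] [AddCommGroup V] [Module K V]
    {k : ℕ} {s : Set V} (hs : k < Module.finrank K (Submodule.span K s)) (v : Fin k → V) :
    ∃ x ∈ s, x ∉ Submodule.span K (Set.range v) := by
  by_contra! h
  have : FiniteDimensional K (Submodule.span K (Set.range v)) :=
    FiniteDimensional.span_of_finite K (Set.finite_range v)
  have h₁ := Submodule.finrank_mono (Submodule.span_le.2 h)
  have h₂ : Module.finrank K (Submodule.span K (Set.range v)) ≤ k :=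
    (finrank_range_le_card v).trans_eq (Fintype.card_fin k)
  omega

/-- A nonzero vector extends to a linearly independent triple by vectors from any set that spans
a space of dimension at least 3. -/
theorem exists_linearIndependent_triple {K V : Type*} [DivisionRing K] [AddCommGroup V]
    [Module K V] {s : Set V} (hs : 3 ≤ Module.finrank K (Submodule.span K s)) {x : V}
    (hx : x ≠ 0) : ∃ y ∈ s, ∃ z ∈ s, LinearIndependent K ![x, y, z] := by
  obtain ⟨y, hy, hxy⟩ := exists_mem_notMem_span_range (Nat.lt_of_succ_lt hs) ![x]
  obtain ⟨z, hz, hxyz⟩ := exists_mem_notMem_span_range hs ![x, y]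
  refine ⟨y, hy, z, hz, ?_⟩
  have hpair : LinearIndependent K ![x, y] := by
    rw [LinearIndependent.pair_iff' hx]
    rintro a rfl
    exact hxy (Submodule.smul_mem _ a (Submodule.subset_span ⟨0, rfl⟩))
  have hsnoc : ![x, y, z] = Fin.snoc ![x, y] z := by
    ext i
    fin_cases i <;> rfl
  rw [hsnoc]
  exact linearIndependent_finSnoc.2 ⟨hpair, hxyz⟩

theorem IsLinearForm.prime {F : Type*} [Field F] {n : ℕ} {ℓ : MvPolynomial (Fin n) F}
    (h : IsLinearForm ℓ) : Prime ℓ := by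
  refine (irreducible_of_totalDegree_eq_one (h.2.totalDegree h.1) fun x hx ↦ ?_).prime
  obtain ⟨d, hd⟩ := ne_zero_iff.1 h.1
  exact (ne_zero_of_dvd_ne_zero hd (hx d)).isUnit

/-- A linear factor of `T₁` coprime to a product `T₂` of linear forms is a candidate linear form
for `T₁ + T₂` when the linear factors of `T₂` span a space of dimension at least 3. -/
theorem isCandidateLinearForm_add {F : Type*} [Field F] {n : ℕ}
    {T₁ T₂ ℓ : MvPolynomial (Fin n) F} (hT₂ : IsProdLinearForms T₂)
    (hdim : 3 ≤ Module.finrank F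
      (Submodule.span F {p : MvPolynomial (Fin n) F | IsLinearForm p ∧ p ∣ T₂}))
    (hℓ : IsLinearForm ℓ) (h₁ : ℓ ∣ T₁) (h₂ : ¬ ℓ ∣ T₂) :
    IsCandidateLinearForm (T₁ + T₂) ℓ := by
  have hmem : ∀ p, p ∣ T₂ → T₁ + T₂ ∈ Ideal.span {ℓ, p} := fun p hp ↦
    add_mem (Ideal.mem_of_dvd _ h₁ (Ideal.subset_span (by simp)))
      (Ideal.mem_of_dvd _ hp (Ideal.subset_span (by simp)))
  refine ⟨hℓ, ?_, ?_⟩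
  · obtain ⟨c, L, hc, hL, rfl⟩ := hT₂
    refine ⟨c, L, hc, fun p hp ↦ ⟨hL p hp, fun hpℓ ↦ h₂ ?_⟩, ?_⟩
    · obtain ⟨a, rfl⟩ := Submodule.mem_span_singleton.1 hpℓ
      exact dvd_smul_of_dvd c ((dvd_smul_of_dvd a dvd_rfl).trans (Multiset.dvd_prod hp))
    · rwa [add_sub_cancel_right, Ideal.mem_span_singleton]
  · obtain ⟨ℓ₁, ⟨hℓ₁, hd₁⟩, ℓ₂, ⟨hℓ₂, hd₂⟩, hind⟩ := exists_linearIndependent_triple hdim hℓ.1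
    exact ⟨ℓ₁, ℓ₂, hℓ₁, hℓ₂, hind, hmem ℓ₁ hd₁, hmem ℓ₂ hd₂⟩

/-- If `T₁ + T₂` has no linear factors and the linear factors of each `Tᵢ` span a space
of dimension at least 3, then every linear factor of `T₁·T₂` is (up to scalar) a
candidate linear form for `T₁ + T₂`. -/
theorem all_gate_factors_are_candidates
    {F : Type*} [Field F] [Fintype F] {n m : ℕ}
    (T₁ T₂ : MvPolynomial (Fin n) F)
    (hm : 1 ≤ m)
    (hT₁ : IsProdLinearForms T₁) (hT₂ : IsProdLinearForms T₂)
    (hT₁hom : T₁.IsHomogeneous m) (hT₂hom : T₂.IsHomogeneous m)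
    (hgcd : ∀ ℓ : MvPolynomial (Fin n) F, IsLinearForm ℓ → ℓ ∣ T₁ → ¬ ℓ ∣ T₂)
    (hnl : NoLinearFactor (T₁ + T₂))
    (hdim₁ : 3 ≤ Module.finrank F
      ↥(Submodule.span F {ℓ : MvPolynomial (Fin n) F | IsLinearForm ℓ ∧ ℓ ∣ T₁}))
    (hdim₂ : 3 ≤ Module.finrank F
      ↥(Submodule.span F {ℓ : MvPolynomial (Fin n) F | IsLinearForm ℓ ∧ ℓ ∣ T₂})) :
    ∀ ℓ : MvPolynomial (Fin n) F, IsLinearForm ℓ → ℓ ∣ T₁ * T₂ →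
      ∃ c : F, c ≠ 0 ∧ IsCandidateLinearForm (T₁ + T₂) (c • ℓ) := by
  intro ℓ hℓ hdvd
  refine ⟨1, one_ne_zero, ?_⟩
  rw [one_smul]
  rcases hℓ.prime.dvd_or_dvd hdvd with h | h
  · exact isCandidateLinearForm_add hT₂ hdim₂ hℓ h (hgcd ℓ hℓ h)
  · rw [add_comm]
    exact isCandidateLinearForm_add hT₁ hdim₁ hℓ h fun h' ↦ hgcd ℓ hℓ h' h
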